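/- Let p ≥ 3 be a natural number and define F₁, F₂ as in the context. Then for every real t ≥ 0, ∑_{k,l ≥ 1, k+l < p} [ F₁(p−k, 3p−l; t) + F₁(2p−k, 2p−l; t) + ∑_{a=1}^∞ F₁(pa+k, 2p+l; t) + 2·F₂(p−k, p+k+l; t) ] > 0, where the outer sum runs over pairs of positive integers (k,l) with k + l < p. -/

import Mathlib

noncomputable def A (p k : ℕ) : ℝ :=
  if k = p then Real.pi / (2 * (p : ℝ)^2)
  else Real.sin (Real.pi * k / p) / ((p : ℝ)^2 - (k : ℝ)^2)

noncomputable def B (p k : ℕ) : ℝ :=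
  if k = 2 * p then -(Real.pi / (2 * (p : ℝ)))
  else (k : ℝ) * Real.sin (Real.pi * k / p) / (4 * (p : ℝ)^2 - (k : ℝ)^2)

noncomputable def F1 (p k l : ℕ) (t : ℝ) : ℝ :=
  A p k * A p (k + l) * B p l *
    Real.exp (-((k : ℝ)^2 + (l : ℝ)^2 + ((k : ℝ) + (l : ℝ))^2) * t)

noncomputable def F2 (p k l : ℕ) (t : ℝ) : ℝ :=
  -(A p k * A p l * B p (k + l)) *
    Real.exp (-((k : ℝ)^2 + (l : ℝ)^2 + ((k : ℝ) + (l : ℝ))^2) * t)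

lemma A_eq_of_cast_eq {p n : ℕ} (hp : 0 < p) (a : ℕ) {c : ℝ}
    (hn : (n : ℝ) = p * (a + 1) + c) (hnp : n ≠ p) :
    A p n = (-1) ^ a * Real.sin (Real.pi * c / p) / ((p * a + c) * (p * (a + 2) + c)) := by
  have hp' : (p : ℝ) ≠ 0 := by positivity
  have harg : Real.pi * n / p = Real.pi * c / p + ((a + 1 : ℕ) : ℝ) * Real.pi := by
    rw [hn]; push_cast; field_simp; ring
  have hden : (p : ℝ) ^ 2 - (n : ℝ) ^ 2 = -((p * a + c) * (p * (a + 2) + c)) := by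
    rw [hn]; ring
  rw [A, if_neg hnp, harg, Real.sin_add_nat_mul_pi, hden, div_neg, ← neg_div]
  congr 1
  ring

lemma B_eq_of_cast_eq {p n : ℕ} (hp : 0 < p) (a : ℕ) {c : ℝ}
    (hn : (n : ℝ) = p * (a + 2) + c) (hnp : n ≠ 2 * p) :
    B p n = -((-1) ^ a * Real.sin (Real.pi * c / p) * (p * (a + 2) + c) /
      ((p * a + c) * (p * (a + 4) + c))) := by
  have hp' : (p : ℝ) ≠ 0 := by positivity
  have harg : Real.pi * n / p = Real.pi * c / p + ((a + 2 : ℕ) : ℝ) * Real.pi := by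
    rw [hn]; push_cast; field_simp; ring
  have hden : 4 * (p : ℝ) ^ 2 - (n : ℝ) ^ 2 = -((p * a + c) * (p * (a + 4) + c)) := by
    rw [hn]; ring
  rw [B, if_neg hnp, harg, Real.sin_add_nat_mul_pi, hden, div_neg, hn]
  congr 2
  ring

/-- The product of sines shared by all terms attached to `(k, l)`; it is symmetric in the three
numbers `k`, `l`, `p - k - l`. -/
noncomputable def sineProduct (p k l : ℕ) : ℝ :=
  Real.sin (Real.pi * k / p) * Real.sin (Real.pi * l / p) * Real.sin (Real.pi * (k + l) / p)

lemma sin_pi_mul_div_pos {p : ℕ} {x : ℝ} (hx : 0 < x) (hxp : x < p) :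
    0 < Real.sin (Real.pi * x / p) := by
  have hp : (0 : ℝ) < p := hx.trans hxp
  apply Real.sin_pos_of_pos_of_lt_pi
  · have := Real.pi_pos
    positivity
  · rw [div_lt_iff₀ hp]
    exact mul_lt_mul_of_pos_left hxp Real.pi_pos

lemma sin_pi_mul_div_eq_of_add_eq {p : ℕ} (hp : 0 < p) {x y : ℝ} (h : x + y = p) :
    Real.sin (Real.pi * x / p) = Real.sin (Real.pi * y / p) := by
  have hp' : (p : ℝ) ≠ 0 := by positivity
  rw [← Real.sin_pi_sub]
  congr 1
  field_simp
  linarith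

lemma sineProduct_pos {p k l : ℕ} (hk : 0 < k) (hl : 0 < l) (h : k + l < p) :
    0 < sineProduct p k l := by
  have h' : (k : ℝ) + l < p := by exact_mod_cast h
  have hk' : (0 : ℝ) < k := by exact_mod_cast hk
  have hl' : (0 : ℝ) < l := by exact_mod_cast hl
  exact mul_pos (mul_pos (sin_pi_mul_div_pos hk' (by linarith))
    (sin_pi_mul_div_pos hl' (by linarith))) (sin_pi_mul_div_pos (by linarith) h')

lemma sineProduct_reflect_right {p k l z : ℕ} (hp : 0 < p) (h : k + l + z = p) :
    sineProduct p k z = sineProduct p k l := by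
  have h' : (k : ℝ) + l + z = p := by exact_mod_cast h
  unfold sineProduct
  rw [sin_pi_mul_div_eq_of_add_eq hp (x := (k : ℝ) + z) (y := l) (by linarith),
    sin_pi_mul_div_eq_of_add_eq hp (x := (k : ℝ) + l) (y := z) (by linarith)]
  ring

lemma sineProduct_reflect_left {p k l z : ℕ} (hp : 0 < p) (h : k + l + z = p) :
    sineProduct p z l = sineProduct p k l := by
  have h' : (k : ℝ) + l + z = p := by exact_mod_cast h
  unfold sineProduct
  rw [sin_pi_mul_div_eq_of_add_eq hp (x := (z : ℝ) + l) (y := k) (by linarith),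
    sin_pi_mul_div_eq_of_add_eq hp (x := (k : ℝ) + l) (y := z) (by linarith)]
  ring

lemma two_mul_F2_eq {p k l : ℕ} (t : ℝ) (hk : 0 < k) (hl : 0 < l) (h : k + l < p) :
    2 * F2 p (p - k) (p + k + l) t = sineProduct p k l *
      (2 * (2 * p + l) / (k * (2 * p - k) * ((k + l) * (2 * p + k + l)) * (l * (4 * p + l)))) *
      Real.exp (-(((p : ℝ) - k) ^ 2 + ((p : ℝ) + k + l) ^ 2 + (2 * (p : ℝ) + l) ^ 2) * t) := by
  have hp : 0 < p := by omega
  have hkp : k ≤ p := by omega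
  have h1 := A_eq_of_cast_eq (n := p - k) hp 0 (c := -k)
    (by rw [Nat.cast_sub hkp]; push_cast; ring) (by omega)
  have h2 := A_eq_of_cast_eq (n := p + k + l) hp 0 (c := k + l) (by push_cast; ring) (by omega)
  have h3 := B_eq_of_cast_eq (n := p - k + (p + k + l)) hp 0 (c := l)
    (by push_cast [Nat.cast_sub hkp]; ring) (by omega)
  rw [F2, h1, h2, h3, sineProduct, Nat.cast_sub hkp]
  have hexp : ((p : ℝ) - k) + ((p + k + l : ℕ) : ℝ) = 2 * p + l := by push_cast; ring
  have n1 : (2 * p - k : ℝ) ≠ 0 := by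
    have : (k : ℝ) ≤ p := by exact_mod_cast hkp
    have : (0 : ℝ) < p := by exact_mod_cast hp
    linarith
  have e1 : (p : ℝ) * 0 + -k = -k := by ring
  have e2 : (p : ℝ) * (0 + 2) + -k = 2 * p - k := by ring
  have e3 : (p : ℝ) * 0 + (k + l) = k + l := by ring
  have e4 : (p : ℝ) * (0 + 2) + (k + l) = 2 * p + k + l := by ring
  have e5 : (p : ℝ) * 0 + l = l := by ring
  have e6 : (p : ℝ) * (0 + 4) + l = 4 * p + l := by ring
  have e7 : (p : ℝ) * (0 + 2) + l = 2 * p + l := by ring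
  rw [hexp]
  push_cast
  simp only [mul_neg, neg_div, Real.sin_neg]
  rw [e1, e2, e3, e4, e5, e6, e7]
  field_simp

lemma two_mul_F2_pos {p k l : ℕ} (t : ℝ) (hk : 0 < k) (hl : 0 < l) (h : k + l < p) :
    0 < 2 * F2 p (p - k) (p + k + l) t := by
  rw [two_mul_F2_eq t hk hl h]
  have hS := sineProduct_pos hk hl h
  have h' : (k : ℝ) + l < p := by exact_mod_cast h
  have hk' : (0 : ℝ) < k := by exact_mod_cast hk
  have hl' : (0 : ℝ) < l := by exact_mod_cast hl
  have : (0 : ℝ) < 2 * p - k := by linarith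
  positivity

lemma mul_mul_exp_le {s q r E E' t : ℝ} (hs : 0 ≤ s) (hr : 0 ≤ r) (hqr : q ≤ r) (hE : E' ≤ E)
    (ht : 0 ≤ t) : s * q * Real.exp (-E * t) ≤ s * r * Real.exp (-E' * t) := by
  have : Real.exp (-E * t) ≤ Real.exp (-E' * t) := by
    rw [Real.exp_le_exp]; nlinarith
  gcongr

lemma weight_le_reflect_right {p k z : ℝ} (hk : 0 < k) (hz : 0 < z) (h : k + z < p) :
    (2 * p + k + z) / (k * (2 * p - k) * ((2 * p + z) * (4 * p + z)) *
        ((k + z) * (4 * p + k + z))) ≤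
      2 * (2 * p + z) / (k * (2 * p - k) * ((k + z) * (2 * p + k + z)) * (z * (4 * p + z))) / 4 := by
  have hP : 0 < p := by linarith
  have n1 : 0 < 2 * p - k := by linarith
  rw [div_div, div_le_div_iff₀ (by positivity) (by positivity)]
  have key : 2 * (2 * p + k + z) ^ 2 * z ≤ (2 * p + z) ^ 2 * (4 * p + k + z) := by
    have a1 : (2 * p + k + z) ^ 2 ≤ (3 * p) ^ 2 := by gcongr; linarith
    have a2 : 8 * p * z ≤ (2 * p + z) ^ 2 := by nlinarith [sq_nonneg (2 * p - z)]
    calc 2 * (2 * p + k + z) ^ 2 * z ≤ 2 * (3 * p) ^ 2 * z := by gcongr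
      _ ≤ (8 * p * z) * (4 * p) := by nlinarith [mul_pos (mul_pos hP hP) hz]
      _ ≤ (2 * p + z) ^ 2 * (4 * p + k + z) := by gcongr; linarith
  have := mul_le_mul_of_nonneg_left key
    (show 0 ≤ 2 * (k * (2 * p - k) * (4 * p + z) * (k + z)) by positivity)
  nlinarith [this]

lemma neg_F1_le_reflect_right {p k l z : ℕ} {t : ℝ} (ht : 0 ≤ t) (hk : 0 < k) (hl : 0 < l)
    (hz : 0 < z) (h : k + l + z = p) :
    -F1 p (p - k) (3 * p - l) t ≤ 2 * F2 p (p - k) (p + k + z) t / 4 := by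
  have hp : 0 < p := by omega
  have hkp : k ≤ p := by omega
  have hlp : l ≤ 3 * p := by omega
  have h' : (k : ℝ) + l + z = p := by exact_mod_cast h
  have hk' : (0 : ℝ) < k := by exact_mod_cast hk
  have hl' : (0 : ℝ) < l := by exact_mod_cast hl
  have hz' : (0 : ℝ) < z := by exact_mod_cast hz
  have h1 := A_eq_of_cast_eq (n := p - k) hp 0 (c := -k)
    (by rw [Nat.cast_sub hkp]; push_cast; ring) (by omega)
  have h2 := A_eq_of_cast_eq (n := p - k + (3 * p - l)) hp 3 (c := -(k + l))
    (by push_cast [Nat.cast_sub hkp, Nat.cast_sub hlp]; ring) (by omega)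
  have h3 := B_eq_of_cast_eq (n := 3 * p - l) hp 1 (c := -l)
    (by push_cast [Nat.cast_sub hlp]; ring) (by omega)
  have hF : -F1 p (p - k) (3 * p - l) t = sineProduct p k l *
      ((2 * p + k + z) / (k * (2 * p - k) * ((2 * p + z) * (4 * p + z)) *
        ((k + z) * (4 * p + k + z)))) *
      Real.exp (-(((p : ℝ) - k) ^ 2 + (3 * (p : ℝ) - l) ^ 2 +
        ((p : ℝ) - k + (3 * p - l)) ^ 2) * t) := by
    rw [F1, h1, h2, h3, sineProduct, Nat.cast_sub hkp, Nat.cast_sub hlp]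
    push_cast
    simp only [mul_neg, neg_div, Real.sin_neg]
    have n1 : (2 * p - k : ℝ) ≠ 0 := by linarith
    have e1 : (p : ℝ) * 0 + -k = -k := by ring
    have e2 : (p : ℝ) * (0 + 2) + -k = 2 * p - k := by ring
    have e3 : (p : ℝ) * 3 + -(k + l) = 2 * p + z := by linarith
    have e4 : (p : ℝ) * (3 + 2) + -(k + l) = 4 * p + z := by linarith
    have e5 : (p : ℝ) * 1 + -l = k + z := by linarith
    have e6 : (p : ℝ) * (1 + 4) + -l = 4 * p + k + z := by linarith
    have e7 : (p : ℝ) * (1 + 2) + -l = 2 * p + k + z := by linarith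
    rw [e1, e2, e3, e4, e5, e6, e7]
    field_simp
  rw [hF, two_mul_F2_eq t hk hz (by omega), sineProduct_reflect_right hp h, mul_div_right_comm,
    mul_div_assoc]
  have n1 : (0 : ℝ) < 2 * p - k := by linarith
  refine mul_mul_exp_le (sineProduct_pos hk hl (by omega)).le (by positivity)
    (weight_le_reflect_right hk' hz' (by linarith)) ?_ ht
  have hl2 : (l : ℝ) = p - k - z := by linarith
  rw [hl2]
  nlinarith

lemma weight_le_reflect_left {p l z : ℝ} (hl : 0 < l) (hz : 0 < z) (h : z + l < p) :
    (2 * p - l) / ((l + z) * (2 * p + l + z) * ((2 * p + z) * (4 * p + z)) * (l * (4 * p - l))) ≤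
      2 * (2 * p + l) / (z * (2 * p - z) * ((z + l) * (2 * p + z + l)) * (l * (4 * p + l))) / 4 := by
  have hP : 0 < p := by linarith
  have n1 : 0 < 2 * p - z := by linarith
  have n2 : 0 < 4 * p - l := by linarith
  have n3 : 0 < 2 * p - l := by linarith
  rw [div_div, div_le_div_iff₀ (by positivity) (by positivity)]
  have a1 : (2 * p - l) * (4 * p + l) ≤ (2 * p + l) * (4 * p - l) := by nlinarith [mul_pos hP hl]
  have a2 : 2 * (z * (2 * p - z)) ≤ (2 * p + z) * (4 * p + z) := by
    nlinarith [mul_pos hP hz, mul_pos hP hP]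
  have key := mul_le_mul a1 a2 (by positivity) (by positivity)
  have := mul_le_mul_of_nonneg_left key
    (show 0 ≤ 2 * ((z + l) * (2 * p + z + l) * l) by positivity)
  nlinarith [this]

lemma neg_F1_le_reflect_left {p k l z : ℕ} {t : ℝ} (ht : 0 ≤ t) (hk : 0 < k) (hl : 0 < l)
    (hz : 0 < z) (h : k + l + z = p) :
    -F1 p (2 * p - k) (2 * p - l) t ≤ 2 * F2 p (p - z) (p + z + l) t / 4 := by
  have hp : 0 < p := by omega
  have hkp : k ≤ 2 * p := by omega
  have hlp : l ≤ 2 * p := by omega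
  have h' : (k : ℝ) + l + z = p := by exact_mod_cast h
  have hk' : (0 : ℝ) < k := by exact_mod_cast hk
  have hl' : (0 : ℝ) < l := by exact_mod_cast hl
  have hz' : (0 : ℝ) < z := by exact_mod_cast hz
  have h1 := A_eq_of_cast_eq (n := 2 * p - k) hp 1 (c := -k)
    (by rw [Nat.cast_sub hkp]; push_cast; ring) (by omega)
  have h2 := A_eq_of_cast_eq (n := 2 * p - k + (2 * p - l)) hp 3 (c := -(k + l))
    (by push_cast [Nat.cast_sub hkp, Nat.cast_sub hlp]; ring) (by omega)
  have h3 := B_eq_of_cast_eq (n := 2 * p - l) hp 0 (c := -l)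
    (by push_cast [Nat.cast_sub hlp]; ring) (by omega)
  have hF : -F1 p (2 * p - k) (2 * p - l) t = sineProduct p k l *
      ((2 * p - l) / ((l + z) * (2 * p + l + z) * ((2 * p + z) * (4 * p + z)) *
        (l * (4 * p - l)))) *
      Real.exp (-((2 * (p : ℝ) - k) ^ 2 + (2 * (p : ℝ) - l) ^ 2 +
        (2 * (p : ℝ) - k + (2 * p - l)) ^ 2) * t) := by
    rw [F1, h1, h2, h3, sineProduct, Nat.cast_sub hkp, Nat.cast_sub hlp]
    push_cast
    simp only [mul_neg, neg_div, Real.sin_neg]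
    have n1 : (4 * p - l : ℝ) ≠ 0 := by linarith
    have e1 : (p : ℝ) * 1 + -k = l + z := by linarith
    have e2 : (p : ℝ) * (1 + 2) + -k = 2 * p + l + z := by linarith
    have e3 : (p : ℝ) * 3 + -(k + l) = 2 * p + z := by linarith
    have e4 : (p : ℝ) * (3 + 2) + -(k + l) = 4 * p + z := by linarith
    have e5 : (p : ℝ) * 0 + -l = -l := by ring
    have e6 : (p : ℝ) * (0 + 4) + -l = 4 * p - l := by ring
    have e7 : (p : ℝ) * (0 + 2) + -l = 2 * p - l := by ring
    rw [e1, e2, e3, e4, e5, e6, e7]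
    field_simp
  rw [hF, two_mul_F2_eq t hz hl (by omega), sineProduct_reflect_left hp h, mul_div_right_comm,
    mul_div_assoc]
  have n1 : (0 : ℝ) < 2 * p - z := by linarith
  refine mul_mul_exp_le (sineProduct_pos hk hl (by omega)).le (by positivity)
    (weight_le_reflect_left hl' hz' (by linarith)) ?_ ht
  have hk2 : (k : ℝ) = p - l - z := by linarith
  rw [hk2]
  nlinarith

lemma weight_le_shift {p k l a : ℝ} (hk : 0 < k) (hl : 0 < l) (h : k + l < p) (ha : 0 ≤ a) :
    (2 * p + l) / ((p * a + k) * (p * (a + 2) + k) *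
        ((p * (a + 2) + (k + l)) * (p * (a + 4) + (k + l))) * (l * (4 * p + l))) ≤
      2 * (2 * p + l) / (k * (2 * p - k) * ((k + l) * (2 * p + k + l)) * (l * (4 * p + l))) *
        (1 / ((a + 1) * (a + 2)) / 4) := by
  have hP : 0 < p := by linarith
  have n1 : 0 < 2 * p - k := by linarith
  rw [div_div, div_mul_div_comm, div_le_div_iff₀ (by positivity) (by positivity)]
  have hpa : k * a ≤ p * a := mul_le_mul_of_nonneg_right (by linarith) ha
  have a1 : k * (a + 1) ≤ p * a + k := by linarith
  have a2 : (2 * p - k) * (a + 2) ≤ 2 * (p * (a + 2) + k) := by nlinarith [mul_nonneg hk.le ha]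
  have a3 : 2 * p + k + l ≤ p * (a + 2) + (k + l) := by nlinarith [mul_nonneg hP.le ha]
  have a4 : 4 * (k + l) ≤ p * (a + 4) + (k + l) := by nlinarith [mul_nonneg hP.le ha]
  have key := mul_le_mul (mul_le_mul a1 a2 (by positivity) (by positivity))
    (mul_le_mul a3 a4 (by positivity) (by positivity)) (by positivity) (by positivity)
  have := mul_le_mul_of_nonneg_left key
    (show 0 ≤ (2 * p + l) * (l * (4 * p + l)) by positivity)
  nlinarith [this]

lemma neg_F1_shift_eq {p k l : ℕ} (t : ℝ) (hk : 0 < k) (hl : 0 < l) (h : k + l < p) (a : ℕ) :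
    -F1 p (p * (a + 1) + k) (2 * p + l) t = sineProduct p k l *
      ((2 * p + l) / ((p * a + k) * (p * (a + 2) + k) *
        ((p * (a + 2) + (k + l)) * (p * (a + 4) + (k + l))) * (l * (4 * p + l)))) *
      Real.exp (-((p * (a + 1) + k : ℝ) ^ 2 + (2 * (p : ℝ) + l) ^ 2 +
        (p * (a + 1) + k + (2 * p + l) : ℝ) ^ 2) * t) := by
  have hp : 0 < p := by omega
  have hle : p ≤ p * (a + 1) := Nat.le_mul_of_pos_right p (Nat.succ_pos a)
  have h1 := A_eq_of_cast_eq (n := p * (a + 1) + k) hp a (c := k) (by push_cast; ring) (by omega)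
  have h2 := A_eq_of_cast_eq (n := p * (a + 1) + k + (2 * p + l)) hp (a + 2) (c := k + l)
    (by push_cast; ring) (by omega)
  have h3 := B_eq_of_cast_eq (n := 2 * p + l) hp 0 (c := l) (by push_cast; ring) (by omega)
  rw [F1, h1, h2, h3, sineProduct]
  have hsq : ((-1 : ℝ) ^ a) ^ 2 = 1 := by rw [← pow_mul, mul_comm, pow_mul]; simp
  have e3 : (p : ℝ) * (a + 2 + 2) + (k + l) = p * (a + 4) + (k + l) := by ring
  have e5 : (p : ℝ) * 0 + l = l := by ring
  have e6 : (p : ℝ) * (0 + 4) + l = 4 * p + l := by ring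
  have e7 : (p : ℝ) * (0 + 2) + l = 2 * p + l := by ring
  push_cast
  rw [e3, e5, e6, e7, pow_add]
  field_simp
  linear_combination Real.sin (Real.pi * k / p) * Real.sin (Real.pi * (k + l) / p) *
    Real.sin (Real.pi * l / p) * hsq

lemma neg_F1_shift_le {p k l : ℕ} {t : ℝ} (ht : 0 ≤ t) (hk : 0 < k) (hl : 0 < l)
    (h : k + l < p) (a : ℕ) :
    -F1 p (p * (a + 1) + k) (2 * p + l) t ≤
      2 * F2 p (p - k) (p + k + l) t / 4 * (1 / (((a : ℝ) + 1) * (a + 2))) := by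
  have h' : (k : ℝ) + l < p := by exact_mod_cast h
  have hk' : (0 : ℝ) < k := by exact_mod_cast hk
  have hl' : (0 : ℝ) < l := by exact_mod_cast hl
  have ha : (0 : ℝ) ≤ a := a.cast_nonneg
  have n1 : (0 : ℝ) < 2 * p - k := by linarith
  have hpa : (0 : ℝ) ≤ p * a := by positivity
  rw [neg_F1_shift_eq t hk hl h a, div_mul_eq_mul_div, mul_div_assoc,
    two_mul_F2_eq t hk hl h, mul_right_comm _ (Real.exp _),
    mul_assoc (sineProduct p k l) (_ / _) (_ / _)]
  refine mul_mul_exp_le (sineProduct_pos hk hl h).le (by positivity)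
    (weight_le_shift hk' hl' h' ha) ?_ ht
  have b1 : ((p : ℝ) - k) ^ 2 ≤ (p * (a + 1) + k : ℝ) ^ 2 :=
    pow_le_pow_left₀ (by linarith) (by nlinarith) 2
  have b2 : ((p : ℝ) + k + l) ^ 2 ≤ (p * (a + 1) + k + (2 * p + l) : ℝ) ^ 2 :=
    pow_le_pow_left₀ (by linarith) (by nlinarith) 2
  linarith

lemma sum_range_one_div_succ_mul_le_one (n : ℕ) :
    ∑ a ∈ Finset.range n, 1 / (((a : ℝ) + 1) * (a + 2)) ≤ 1 := by
  have key : ∑ a ∈ Finset.range n, 1 / (((a : ℝ) + 1) * (a + 2)) = 1 - 1 / ((n : ℝ) + 1) := by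
    induction n with
    | zero => simp
    | succ n ih =>
      rw [Finset.sum_range_succ, ih]
      push_cast
      field_simp
      ring
  rw [key]
  have : (0 : ℝ) ≤ 1 / ((n : ℝ) + 1) := by positivity
  linarith

lemma neg_tsum_F1_shift_le {p k l : ℕ} {t : ℝ} (ht : 0 ≤ t) (hk : 0 < k) (hl : 0 < l)
    (h : k + l < p) :
    -∑' a : ℕ, F1 p (p * (a + 1) + k) (2 * p + l) t ≤ 2 * F2 p (p - k) (p + k + l) t / 4 := by
  rw [← tsum_neg]
  refine Real.tsum_le_of_sum_range_le (fun a => ?_) (fun n => ?_)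
  · rw [neg_F1_shift_eq t hk hl h a]
    have := sineProduct_pos hk hl h
    positivity
  · have hG := two_mul_F2_pos t hk hl h
    calc ∑ a ∈ Finset.range n, -F1 p (p * (a + 1) + k) (2 * p + l) t
        ≤ ∑ a ∈ Finset.range n,
          2 * F2 p (p - k) (p + k + l) t / 4 * (1 / (((a : ℝ) + 1) * (a + 2))) :=
          Finset.sum_le_sum fun a _ => neg_F1_shift_le ht hk hl h a
      _ = 2 * F2 p (p - k) (p + k + l) t / 4 *
          ∑ a ∈ Finset.range n, 1 / (((a : ℝ) + 1) * (a + 2)) := by rw [Finset.mul_sum]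
      _ ≤ 2 * F2 p (p - k) (p + k + l) t / 4 :=
          mul_le_of_le_one_right (by linarith) (sum_range_one_div_succ_mul_le_one n)

/-- Pairs of positive integers `(k, l)` with `k + l < p`. -/
def trianglePairs (p : ℕ) : Finset (ℕ × ℕ) :=
  (Finset.Ico 1 p ×ˢ Finset.Ico 1 p).filter fun x => x.1 + x.2 < p

lemma mem_trianglePairs {p : ℕ} {x : ℕ × ℕ} :
    x ∈ trianglePairs p ↔ 0 < x.1 ∧ 0 < x.2 ∧ x.1 + x.2 < p := by
  simp only [trianglePairs, Finset.mem_filter, Finset.mem_product, Finset.mem_Ico]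
  omega

lemma sum_trianglePairs_reflect_right (p : ℕ) (f : ℕ → ℕ → ℝ) :
    ∑ x ∈ trianglePairs p, f x.1 (p - x.1 - x.2) = ∑ x ∈ trianglePairs p, f x.1 x.2 := by
  refine Finset.sum_nbij' (fun x => (x.1, p - x.1 - x.2)) (fun x => (x.1, p - x.1 - x.2))
    ?_ ?_ ?_ ?_ (fun _ _ => rfl)
  all_goals grind [mem_trianglePairs]

lemma sum_trianglePairs_reflect_left (p : ℕ) (f : ℕ → ℕ → ℝ) :
    ∑ x ∈ trianglePairs p, f (p - x.1 - x.2) x.2 = ∑ x ∈ trianglePairs p, f x.1 x.2 := by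
  refine Finset.sum_nbij' (fun x => (p - x.1 - x.2, x.2)) (fun x => (p - x.1 - x.2, x.2))
    ?_ ?_ ?_ ?_ (fun _ _ => rfl)
  all_goals grind [mem_trianglePairs]

theorem I_plus_L_pos (p : ℕ) (hp : 3 ≤ p) (t : ℝ) (ht : 0 ≤ t) :
    0 < ∑ k ∈ Finset.Ico 1 p, ∑ l ∈ Finset.Ico 1 p,
        if k + l < p then
          F1 p (p - k) (3 * p - l) t + F1 p (2 * p - k) (2 * p - l) t
            + (∑' a : ℕ, F1 p (p * (a + 1) + k) (2 * p + l) t)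
            + 2 * F2 p (p - k) (p + k + l) t
        else 0 := by
  have hsum : ∀ f : ℕ → ℕ → ℝ, ∑ k ∈ Finset.Ico 1 p, ∑ l ∈ Finset.Ico 1 p,
      (if k + l < p then f k l else 0) = ∑ x ∈ trianglePairs p, f x.1 x.2 := fun f => by
    rw [trianglePairs, Finset.sum_filter, Finset.sum_product]
  rw [hsum fun k l => F1 p (p - k) (3 * p - l) t + F1 p (2 * p - k) (2 * p - l) t
    + (∑' a : ℕ, F1 p (p * (a + 1) + k) (2 * p + l) t) + 2 * F2 p (p - k) (p + k + l) t]
  let G : ℕ → ℕ → ℝ := fun k l => 2 * F2 p (p - k) (p + k + l) t / 4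
  have hG : 0 < ∑ x ∈ trianglePairs p, G x.1 x.2 := by
    refine Finset.sum_pos (fun x hx => ?_) ⟨(1, 1), mem_trianglePairs.2 (by simp; omega)⟩
    obtain ⟨hk, hl, h⟩ := mem_trianglePairs.1 hx
    exact div_pos (two_mul_F2_pos t hk hl h) (by norm_num)
  have hle : ∑ x ∈ trianglePairs p,
      (3 * G x.1 x.2 - G x.1 (p - x.1 - x.2) - G (p - x.1 - x.2) x.2) ≤
      ∑ x ∈ trianglePairs p, (F1 p (p - x.1) (3 * p - x.2) t + F1 p (2 * p - x.1) (2 * p - x.2) t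
        + (∑' a : ℕ, F1 p (p * (a + 1) + x.1) (2 * p + x.2) t)
        + 2 * F2 p (p - x.1) (p + x.1 + x.2) t) := by
    refine Finset.sum_le_sum fun x hx => ?_
    obtain ⟨hk, hl, h⟩ := mem_trianglePairs.1 hx
    have h1 := neg_F1_le_reflect_right (p := p) (z := p - x.1 - x.2) ht hk hl (by omega) (by omega)
    have h2 := neg_F1_le_reflect_left (p := p) (z := p - x.1 - x.2) ht hk hl (by omega) (by omega)
    have h3 := neg_tsum_F1_shift_le ht hk hl h
    simp only [G]
    linarith
  refine lt_of_lt_of_le ?_ hle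
  rw [Finset.sum_sub_distrib, Finset.sum_sub_distrib, sum_trianglePairs_reflect_right p G,
    sum_trianglePairs_reflect_left p G, ← Finset.mul_sum]
  linarith
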